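/- For each sign ε ∈ {+, −}, the map κ_{U_G} : (x, ξ) ↦ ((M(ξ)ᵀ)⁻¹ x, g(ξ)) is injective on ℝ^d × D_ε, where D_ε = {ξ ∈ ℝ^d : ‖ξ‖ < 1 and ε⟨σ(ξ), a⟩ > 0} (on which M(ξ) is invertible). -/

import Mathlib

open Matrix

noncomputable section

/-- `f ξ = √(1 - ‖ξ‖²)` (Euclidean norm, written via the dot product). -/
def fH {d : ℕ} (ξ : Fin d → ℝ) : ℝ := Real.sqrt (1 - ξ ⬝ᵥ ξ)

/-- `σ ξ = (f ξ, ξ) ∈ ℝ^{1+d}`. -/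
def sigmaH {d : ℕ} (ξ : Fin d → ℝ) : Fin (d + 1) → ℝ := Fin.cons (fH ξ) ξ

/-- `π (x₀, x) = x`. -/
def piH {d : ℕ} (z : Fin (d + 1) → ℝ) : Fin d → ℝ := fun i => z i.succ

/-- `e₀ = (1, 0, …, 0)`. -/
def e0H {d : ℕ} : Fin (d + 1) → ℝ := fun i => if i = 0 then 1 else 0

/-- the lower-right `d × d` block of `G`. -/
def G0H {d : ℕ} (G : Matrix (Fin (d + 1)) (Fin (d + 1)) ℝ) : Matrix (Fin d) (Fin d) ℝ :=
  fun i j => G i.succ j.succ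

/-- `b = π (Gᵀ e₀)`. -/
def bH {d : ℕ} (G : Matrix (Fin (d + 1)) (Fin (d + 1)) ℝ) : Fin d → ℝ :=
  piH (Gᵀ.mulVec e0H)

/-- `g ξ = π (Gᵀ σ(ξ))`. -/
def gH {d : ℕ} (G : Matrix (Fin (d + 1)) (Fin (d + 1)) ℝ) (ξ : Fin d → ℝ) : Fin d → ℝ :=
  piH (Gᵀ.mulVec (sigmaH ξ))

/-- `a = (Gᵀ)⁻¹ e₀`. -/
def aH {d : ℕ} (G : Matrix (Fin (d + 1)) (Fin (d + 1)) ℝ) : Fin (d + 1) → ℝ :=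
  (Gᵀ)⁻¹.mulVec e0H

/-- The matrix of the linear map `M(ξ) : v ↦ G₀ᵀ v - (⟨ξ, v⟩ / f ξ) • b`. -/
def MH {d : ℕ} (G : Matrix (Fin (d + 1)) (Fin (d + 1)) ℝ) (ξ : Fin d → ℝ) :
    Matrix (Fin d) (Fin d) ℝ :=
  (G0H G)ᵀ - (fH ξ)⁻¹ • vecMulVec (bH G) ξ

/-- `κ_{U_G} (x, ξ) = ((M(ξ)ᵀ)⁻¹ x, g(ξ))`. -/
def kappaG {d : ℕ} (G : Matrix (Fin (d + 1)) (Fin (d + 1)) ℝ)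
    (p : (Fin d → ℝ) × (Fin d → ℝ)) : (Fin d → ℝ) × (Fin d → ℝ) :=
  (((MH G p.2)ᵀ)⁻¹.mulVec p.1, gH G p.2)

lemma sigmaH_dotProduct_self {d : ℕ} {ξ : Fin d → ℝ} (h : ξ ⬝ᵥ ξ < 1) :
    sigmaH ξ ⬝ᵥ sigmaH ξ = 1 := by
  have hf : fH ξ * fH ξ = 1 - ξ ⬝ᵥ ξ := Real.mul_self_sqrt (by linarith)
  simp only [dotProduct, sigmaH, Fin.sum_univ_succ, Fin.cons_zero, Fin.cons_succ] at hf ⊢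
  linarith

/-- A vector `z` whose image `Gᵀ z` has vanishing projection is a multiple of `a`. -/
lemma eq_smul_aH_of_piH_eq_zero {d : ℕ} {G : Matrix (Fin (d + 1)) (Fin (d + 1)) ℝ}
    (hG : IsUnit G.det) {z : Fin (d + 1) → ℝ} (hz : piH (Gᵀ.mulVec z) = 0) :
    ∃ t : ℝ, z = t • aH G := by
  refine ⟨Gᵀ.mulVec z 0, ?_⟩
  have h : Gᵀ.mulVec z = Gᵀ.mulVec z 0 • e0H := by
    ext i
    refine Fin.cases ?_ (fun j => ?_) i
    · simp [e0H]
    · simpa [e0H, piH] using congrFun hz j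
  have hG' : IsUnit (Gᵀ).det := by rwa [det_transpose]
  rw [aH, ← mulVec_smul, ← h, mulVec_mulVec, nonsing_inv_mul _ hG', one_mulVec]

lemma MH_mulVec {d : ℕ} (G : Matrix (Fin (d + 1)) (Fin (d + 1)) ℝ) (ξ v : Fin d → ℝ) :
    (MH G ξ).mulVec v =
      piH (Gᵀ.mulVec (Fin.cons (-((fH ξ)⁻¹ * (ξ ⬝ᵥ v))) v)) := by
  ext i
  rw [MH, sub_mulVec, smul_mulVec, vecMulVec_mulVec]
  simp [piH, bH, mulVec, dotProduct, Fin.sum_univ_succ, e0H, G0H]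
  ring

lemma isUnit_MH {d : ℕ} {G : Matrix (Fin (d + 1)) (Fin (d + 1)) ℝ} (hG : IsUnit G.det)
    {ξ : Fin d → ℝ} (hξ : ξ ⬝ᵥ ξ < 1) (ha : sigmaH ξ ⬝ᵥ aH G ≠ 0) : IsUnit (MH G ξ) := by
  rw [← mulVec_injective_iff_isUnit]
  refine (injective_iff_map_eq_zero (MH G ξ).mulVecLin).2 fun v hv => ?_
  rw [mulVecLin_apply, MH_mulVec] at hv
  obtain ⟨t, ht⟩ := eq_smul_aH_of_piH_eq_zero hG hv
  have hf : fH ξ ≠ 0 := (Real.sqrt_pos.2 (by linarith)).ne'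
  have horth : sigmaH ξ ⬝ᵥ (Fin.cons (-((fH ξ)⁻¹ * (ξ ⬝ᵥ v))) v : Fin (d + 1) → ℝ) = 0 := by
    have : fH ξ * -((fH ξ)⁻¹ * (ξ ⬝ᵥ v)) + ξ ⬝ᵥ v = 0 := by
      field_simp
      ring
    simpa [dotProduct, sigmaH, Fin.sum_univ_succ] using this
  rw [ht, dotProduct_smul, smul_eq_mul] at horth
  obtain rfl := (mul_eq_zero.1 horth).resolve_right ha
  ext i
  simpa using congrFun ht i.succ

lemma gH_injOn {d : ℕ} {G : Matrix (Fin (d + 1)) (Fin (d + 1)) ℝ} (hG : IsUnit G.det) (ε : ℝ) :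
    Set.InjOn (gH G) {ξ | ξ ⬝ᵥ ξ < 1 ∧ 0 < ε * (sigmaH ξ ⬝ᵥ aH G)} := by
  rintro ξ ⟨hξ, hξa⟩ η ⟨hη, hηa⟩ h
  have hz : piH (Gᵀ.mulVec (sigmaH ξ - sigmaH η)) = 0 := by
    ext i
    simpa [mulVec_sub, piH, gH, sub_eq_zero] using congrFun h i
  obtain ⟨t, ht⟩ := eq_smul_aH_of_piH_eq_zero hG hz
  have horth : (sigmaH ξ + sigmaH η) ⬝ᵥ (sigmaH ξ - sigmaH η) = 0 := by
    rw [add_dotProduct, dotProduct_sub, dotProduct_sub, sigmaH_dotProduct_self hξ,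
      sigmaH_dotProduct_self hη, dotProduct_comm (sigmaH η)]
    ring
  rw [ht, dotProduct_smul, smul_eq_mul, add_dotProduct] at horth
  have hne : sigmaH ξ ⬝ᵥ aH G + sigmaH η ⬝ᵥ aH G ≠ 0 := by
    intro h0
    have : ε * (sigmaH ξ ⬝ᵥ aH G + sigmaH η ⬝ᵥ aH G) = 0 := by rw [h0, mul_zero]
    linarith
  obtain rfl := (mul_eq_zero.1 horth).resolve_right hne
  rw [zero_smul, sub_eq_zero] at ht
  ext i
  simpa [sigmaH] using congrFun ht i.succ

/-- `κ_{U_G}` is injective on `ℝ^d × D_ε`, where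
`D_ε = {ξ : ‖ξ‖ < 1, ε⟨σ(ξ), a⟩ > 0}`, `ε = ±1`. -/
theorem stmt_13 (d : ℕ) (hd : 1 ≤ d) (G : Matrix (Fin (d + 1)) (Fin (d + 1)) ℝ)
    (hG : IsUnit G.det) (ε : ℝ) (hε : ε = 1 ∨ ε = -1) :
    Set.InjOn (kappaG G)
      {p : (Fin d → ℝ) × (Fin d → ℝ) |
        p.2 ⬝ᵥ p.2 < 1 ∧ 0 < ε * (sigmaH p.2 ⬝ᵥ aH G)} := by
  rintro ⟨x, ξ⟩ ⟨hξ, hξa⟩ ⟨y, η⟩ ⟨hη, hηa⟩ h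
  obtain ⟨h1, h2⟩ := Prod.mk.inj h
  obtain rfl : ξ = η := gH_injOn hG ε ⟨hξ, hξa⟩ ⟨hη, hηa⟩ h2
  have hM : IsUnit ((MH G ξ)ᵀ)⁻¹ := by
    rw [isUnit_nonsing_inv_iff, isUnit_transpose]
    exact isUnit_MH hG hξ (right_ne_zero_of_mul hξa.ne')
  obtain rfl : x = y := mulVec_injective_iff_isUnit.2 hM h1
  rfl

end
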